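/- For a compact metric space X and p ≥ 1, the upper metric order of the space of Borel probability measures on X with the p-Wasserstein metric is at most the upper box-counting dimension of X. -/

import Mathlib

open MeasureTheory Filter Metric Set
open scoped NNReal ENNReal

noncomputable section

/-- The set of transport plans (couplings) between two measures. -/
def couplings {X : Type*} [MeasurableSpace X] (μ ν : Measure X) : Set (Measure (X × X)) :=
  {π | π.map Prod.fst = μ ∧ π.map Prod.snd = ν}

/-- The `p`-Wasserstein distance between two measures. -/
noncomputable def Wass {X : Type*} [MetricSpace X] [MeasurableSpace X] (p : ℝ)
    (μ ν : Measure X) : ℝ :=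
  sInf ((fun π : Measure (X × X) => (∫ z, dist z.1 z.2 ^ p ∂π) ^ (1 / p)) '' couplings μ ν)

/-- Covering number: minimal cardinality of an `ε`-dense set. -/
noncomputable def coverNum (X : Type*) [MetricSpace X] (ε : ℝ) : ℕ :=
  sInf {n | ∃ F : Finset X, F.card = n ∧ ∀ x : X, ∃ y ∈ F, dist x y ≤ ε}

/-- Packing number: maximal cardinality of an `ε`-separated set. -/
noncomputable def packNum (X : Type*) [MetricSpace X] (ε : ℝ) : ℕ :=
  sSup {n | ∃ F : Finset X, F.card = n ∧ ∀ x ∈ F, ∀ y ∈ F, x ≠ y → ε < dist x y}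

/-- The (topological) support of a measure. -/
def msupport {X : Type*} [TopologicalSpace X] [MeasurableSpace X] (μ : Measure X) : Set X :=
  {x | ∀ U : Set X, IsOpen U → x ∈ U → 0 < μ U}

/-- Quantization number of `μ` at scale `ε` w.r.t. the `q`-Wasserstein metric. -/
noncomputable def quantW {Y : Type*} [MetricSpace Y] [MeasurableSpace Y] (q : ℝ)
    (μ : Measure Y) (ε : ℝ) : ℕ :=
  sInf {n | ∃ ν : Measure Y, IsProbabilityMeasure ν ∧
    (∃ S : Finset Y, S.card = n ∧ ν (↑S)ᶜ = 0) ∧ Wass q μ ν ≤ ε}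

end

/-- Covering number of the space of probability measures w.r.t. the `p`-Wasserstein distance. -/
noncomputable def coverWass (X : Type*) [MetricSpace X] [MeasurableSpace X] (p : ℝ)
    (ε : ℝ) : ℕ :=
  sInf {n | ∃ F : Finset (Measure X), F.card = n ∧ (∀ μ ∈ F, IsProbabilityMeasure μ) ∧
    ∀ μ : Measure X, IsProbabilityMeasure μ → ∃ ν ∈ F, Wass p μ ν ≤ ε}

lemma coupling_cost_bdd {X : Type*} [MetricSpace X] [MeasurableSpace X] (p : ℝ)
    (μ ν : Measure X) :
    BddBelow ((fun π : Measure (X × X) => (∫ z, dist z.1 z.2 ^ p ∂π) ^ (1 / p)) ''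
      couplings μ ν) := by
  refine ⟨0, ?_⟩
  rintro _ ⟨π, -, rfl⟩
  exact Real.rpow_nonneg (integral_nonneg fun z => Real.rpow_nonneg dist_nonneg _) _

lemma wass_le_of_coupling {X : Type*} [MetricSpace X] [MeasurableSpace X] {p : ℝ} (hp : 1 ≤ p)
    {μ ν : Measure X} {π : Measure (X × X)} (hπ : π ∈ couplings μ ν) {ε : ℝ} (hε : 0 ≤ ε)
    (h : ∫ z, dist z.1 z.2 ^ p ∂π ≤ ε ^ p) : Wass p μ ν ≤ ε := by
  have h1 : Wass p μ ν ≤ (∫ z, dist z.1 z.2 ^ p ∂π) ^ (1 / p) :=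
    csInf_le (coupling_cost_bdd p μ ν) ⟨π, hπ, rfl⟩
  refine h1.trans ?_
  calc (∫ z, dist z.1 z.2 ^ p ∂π) ^ (1 / p) ≤ (ε ^ p) ^ (1 / p) :=
        Real.rpow_le_rpow (integral_nonneg fun z => Real.rpow_nonneg dist_nonneg _) h
          (by positivity)
    _ = ε := by
        rw [← Real.rpow_mul hε, mul_one_div_cancel (by linarith), Real.rpow_one]

/-- The discretised measure. -/
noncomputable def discMeas {X : Type*} [MeasurableSpace X] (F : Finset X) (x0 : X) (m : ℕ)
    (k : X → ℕ) : Measure X :=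
  ∑ i ∈ F, ((k i : ℝ≥0∞) / m) • Measure.dirac i
    + (1 - ∑ i ∈ F, (k i : ℝ≥0∞) / m) • Measure.dirac x0

lemma exists_disc {X : Type*} [MetricSpace X] [CompactSpace X] [MeasurableSpace X] [BorelSpace X]
    {p : ℝ} (hp : 1 ≤ p) (F : Finset X) (x0 : X) (T : X → X) (hT : Measurable T)
    (hTF : ∀ x, T x ∈ F) {δ R : ℝ} (hδ : 0 ≤ δ) (hTd : ∀ x, dist x (T x) ≤ δ)
    (hR : ∀ x y : X, dist x y ≤ R) (m : ℕ) (hm : 0 < m) (μ : Measure X)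
    [IsProbabilityMeasure μ] :
    ∃ k : X → ℕ, (∀ i, k i ≤ m) ∧ IsProbabilityMeasure (discMeas F x0 m k) ∧
      ∃ π ∈ couplings μ (discMeas F x0 m k),
        ∫ z, dist z.1 z.2 ^ p ∂π ≤ δ ^ p + R ^ p * (F.card / m) := by
  classical
  have hR0 : 0 ≤ R := dist_nonneg.trans (hR x0 x0)
  have : SecondCountableTopology X := by
    have : TopologicalSpace.SeparableSpace X := inferInstance
    exact UniformSpace.secondCountable_of_separable X
  set A : X → Set X := fun i => T ⁻¹' {i} with hA
  have hAm : ∀ i, MeasurableSet (A i) := fun i => hT (measurableSet_singleton i)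
  set k : X → ℕ := fun i => ⌊(m : ℝ) * μ.real (A i)⌋₊ with hk
  have hm' : (0 : ℝ) < m := by exact_mod_cast hm
  have hkle : ∀ i, (k i : ℝ) ≤ m * μ.real (A i) := fun i => Nat.floor_le (by positivity)
  have hkge : ∀ i, m * μ.real (A i) ≤ (k i : ℝ) + 1 := fun i => (Nat.lt_floor_add_one _).le
  have hm0 : (m : ℝ≥0∞) ≠ 0 := by exact_mod_cast hm.ne'
  have hmt : (m : ℝ≥0∞) ≠ ∞ := ENNReal.natCast_ne_top m
  have hμA : ∀ i, μ (A i) = ENNReal.ofReal (μ.real (A i)) := fun i => by simp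
  have hdiv : ∀ j : ℕ, (j : ℝ≥0∞) / m = ENNReal.ofReal ((j : ℝ) / m) := fun j => by
    rw [ENNReal.ofReal_div_of_pos hm']; simp
  have hkle' : ∀ i, (k i : ℝ≥0∞) / m ≤ μ (A i) := fun i => by
    rw [hμA, hdiv]
    apply ENNReal.ofReal_le_ofReal
    rw [div_le_iff₀ hm', mul_comm]; exact hkle i
  have hkge' : ∀ i, μ (A i) ≤ (k i : ℝ≥0∞) / m + 1 / m := fun i => by
    rw [← ENNReal.add_div, hμA]
    have := hdiv (k i + 1)
    push_cast at this
    rw [this]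
    apply ENNReal.ofReal_le_ofReal
    rw [le_div_iff₀ hm', mul_comm]; exact hkge i
  set c : X → ℝ≥0∞ := fun i => ((k i : ℝ≥0∞) / m) / μ (A i) with hc
  have hcm : ∀ i, c i * μ (A i) = (k i : ℝ≥0∞) / m := fun i => by
    by_cases h : μ (A i) = 0
    · have := hkle' i
      rw [h] at this
      rw [h, mul_zero]
      exact (le_antisymm this (zero_le)).symm
    · exact ENNReal.div_mul_cancel h (measure_ne_top _ _)
  have hc1 : ∀ i, c i ≤ 1 := fun i => ENNReal.div_le_of_le_mul (by rw [one_mul]; exact hkle' i)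
  set μ2 : Measure X := ∑ i ∈ F, (1 - c i) • μ.restrict (A i) with hμ2
  have hdecomp : ∑ i ∈ F, μ.restrict (A i) = μ := by
    have hU : (⋃ i ∈ F, A i) = univ := by
      ext x; simp [hA, hTF]
    have h1 : μ.restrict (⋃ i ∈ F, A i) = ∑ i ∈ F, μ.restrict (A i) := by
      rw [Measure.restrict_biUnion_finset]
      · exact Measure.sum_coe_finset F (fun i => μ.restrict (A i))
      · intro i _ j _ hij
        exact Disjoint.preimage _ (by simpa using hij)
      · intro i; exact hAm i
    rw [← h1, hU, Measure.restrict_univ]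
  set π1 : Measure (X × X) := ∑ i ∈ F, c i • (μ.restrict (A i)).map (fun x => (x, i)) with hπ1
  set π : Measure (X × X) := π1 + μ2.map (fun x => (x, x0)) with hπ
  have hmi : ∀ i : X, Measurable (fun x : X => (x, i)) := fun i => by fun_prop
  have hfst : π.map Prod.fst = μ := by
    rw [hπ, Measure.map_add _ _ measurable_fst, hπ1,
      Measure.map_finset_sum measurable_fst.aemeasurable,
      Measure.map_map measurable_fst (hmi x0)]
    simp only [Measure.map_smul, Measure.map_map measurable_fst (hmi _)]
    have : ∀ i : X, (Prod.fst ∘ fun x : X => (x, i)) = id := fun i => rfl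
    simp only [this, Measure.map_id]
    rw [hμ2, ← Finset.sum_add_distrib]
    conv_rhs => rw [← hdecomp]
    refine Finset.sum_congr rfl fun i _ => ?_
    rw [← add_smul, add_tsub_cancel_of_le (hc1 i), one_smul]
  have hμ2u' : μ2 univ + ∑ i ∈ F, (k i : ℝ≥0∞) / m = 1 := by
    have : (1 : ℝ≥0∞) = ∑ i ∈ F, μ (A i) := by
      conv_lhs => rw [← measure_univ (μ := μ), ← hdecomp]
      simp
    rw [this, hμ2]
    simp only [Measure.coe_finsetSum, Finset.sum_apply, Measure.smul_apply, smul_eq_mul,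
      Measure.restrict_apply_univ]
    rw [← Finset.sum_add_distrib]
    refine Finset.sum_congr rfl fun i _ => ?_
    rw [← hcm, ← add_mul, tsub_add_cancel_of_le (hc1 i), one_mul]
  have hμ2u : μ2 univ = 1 - ∑ i ∈ F, (k i : ℝ≥0∞) / m := by
    refine ENNReal.eq_sub_of_add_eq ?_ hμ2u'
    refine ne_top_of_le_ne_top ENNReal.one_ne_top (hμ2u' ▸ le_add_self)
  have hμ2le : μ2 univ ≤ F.card / m := by
    rw [hμ2]
    simp only [Measure.coe_finsetSum, Finset.sum_apply, Measure.smul_apply, smul_eq_mul,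
      Measure.restrict_apply_univ]
    have : (F.card : ℝ≥0∞) / m = ∑ i ∈ F, 1 / (m : ℝ≥0∞) := by
      rw [Finset.sum_const, nsmul_eq_mul, mul_one_div]
    rw [this]
    refine Finset.sum_le_sum fun i _ => ?_
    rw [ENNReal.sub_mul (fun _ _ => measure_ne_top _ _), one_mul, hcm, tsub_le_iff_left]
    exact hkge' i
  have hsnd : π.map Prod.snd = discMeas F x0 m k := by
    rw [hπ, Measure.map_add _ _ measurable_snd, hπ1,
      Measure.map_finset_sum measurable_snd.aemeasurable,
      Measure.map_map measurable_snd (hmi x0)]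
    simp only [Measure.map_smul, Measure.map_map measurable_snd (hmi _)]
    have : ∀ i : X, (Prod.snd ∘ fun x : X => (x, i)) = fun _ => i := fun i => rfl
    simp only [this, Measure.map_const, Measure.restrict_apply_univ]
    rw [hμ2u, discMeas]
    congr 1
    refine Finset.sum_congr rfl fun i _ => ?_
    rw [smul_smul, hcm]
  have hπu : IsProbabilityMeasure π := by
    constructor
    have : (π.map Prod.fst) univ = 1 := by rw [hfst]; exact measure_univ
    rwa [Measure.map_apply measurable_fst MeasurableSet.univ, preimage_univ] at this
  refine ⟨k, ?_, ?_, π, ⟨hfst, hsnd⟩, ?_⟩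
  · intro i
    have h1 : μ.real (A i) ≤ 1 := measureReal_le_one
    have := hkle i
    have : (k i : ℝ) ≤ m := by nlinarith
    exact_mod_cast this
  · rw [← hsnd]
    exact Measure.isProbabilityMeasure_map measurable_snd.aemeasurable
  · set B : Set (X × X) := {z | δ < dist z.1 z.2} with hB
    have hBm : MeasurableSet B := measurableSet_lt measurable_const (by fun_prop)
    have hπB : π B ≤ F.card / m := by
      rw [hπ, Measure.add_apply]
      have h1 : π1 B = 0 := by
        rw [hπ1]
        simp only [Measure.coe_finsetSum, Finset.sum_apply, Measure.smul_apply, smul_eq_mul]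
        refine Finset.sum_eq_zero fun i _ => ?_
        rw [Measure.map_apply (hmi i) hBm, Measure.restrict_apply (hmi i hBm)]
        have : ((fun x : X => (x, i)) ⁻¹' B) ∩ A i = ∅ := by
          ext x
          simp only [hB, hA, mem_inter_iff, mem_preimage, mem_ofPred_eq, mem_singleton_iff,
            mem_empty_iff_false, iff_false, not_and]
          rintro h rfl
          exact absurd (hTd x) (not_le.mpr h)
        rw [this]; simp
      rw [h1, zero_add, Measure.map_apply (hmi x0) hBm]
      exact (measure_mono (subset_univ _)).trans hμ2le
    have hπB' : π.real B ≤ F.card / m := by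
      rw [Measure.real]
      refine ENNReal.toReal_le_of_le_ofReal (by positivity) ?_
      rw [← hdiv]; exact hπB
    have hp0 : 0 ≤ p := by linarith
    calc ∫ z, dist z.1 z.2 ^ p ∂π ≤ ∫ z, (δ ^ p + B.indicator (fun _ => R ^ p) z) ∂π := by
          refine integral_mono_of_nonneg ?_ ?_ ?_
          · exact Eventually.of_forall fun z => Real.rpow_nonneg dist_nonneg _
          · exact (integrable_const _).add ((integrable_const _).indicator hBm)
          · refine Eventually.of_forall fun z => ?_
            by_cases hz : z ∈ B
            · simp only [hz, indicator_of_mem]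
              have := Real.rpow_le_rpow dist_nonneg (hR z.1 z.2) hp0
              have := Real.rpow_nonneg hδ p
              linarith
            · simp only [hz, not_false_eq_true, indicator_of_notMem, add_zero]
              exact Real.rpow_le_rpow dist_nonneg (by simpa [hB] using hz) hp0
      _ = δ ^ p + R ^ p * π.real B := by
          rw [integral_add (integrable_const _) ((integrable_const _).indicator hBm),
            integral_indicator_const _ hBm]
          simp [mul_comm]
      _ ≤ _ := by gcongr

lemma coverNum_spec (X : Type*) [MetricSpace X] [CompactSpace X] {ε : ℝ} (hε : 0 < ε) :
    ∃ F : Finset X, F.card = coverNum X ε ∧ ∀ x : X, ∃ y ∈ F, dist x y ≤ ε := by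
  have : coverNum X ε ∈ {n | ∃ F : Finset X, F.card = n ∧ ∀ x : X, ∃ y ∈ F, dist x y ≤ ε} := by
    apply Nat.sInf_mem
    obtain ⟨t, -, ht, hc⟩ := finite_cover_balls_of_compact (isCompact_univ (X := X)) hε
    refine ⟨_, ht.toFinset, rfl, fun x => ?_⟩
    have := hc (mem_univ x)
    simp only [mem_iUnion, mem_ball] at this
    obtain ⟨y, hy, h⟩ := this
    exact ⟨y, by simpa using hy, h.le⟩
  exact this

lemma exists_nearest {X : Type*} [MetricSpace X] [MeasurableSpace X] [BorelSpace X] [Nonempty X]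
    (F : Finset X) {δ : ℝ} (hF : ∀ x : X, ∃ y ∈ F, dist x y ≤ δ) :
    ∃ T : X → X, Measurable T ∧ (∀ x, T x ∈ F) ∧ ∀ x, dist x (T x) ≤ δ := by
  obtain ⟨x0, hx0, -⟩ := hF (Classical.arbitrary X)
  set e : ℕ → X := fun n => F.toList.getD n x0 with he
  have heF : ∀ n, e n ∈ F := fun n => by
    rw [he]
    by_cases h : n < F.toList.length
    · simp only [List.getD_eq_getElem _ _ h]
      exact Finset.mem_toList.mp (List.getElem_mem h)
    · simp only [List.getD_eq_default _ _ (not_lt.mp h)]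
      exact hx0
  refine ⟨SimpleFunc.nearestPt e F.card, SimpleFunc.measurable _, fun x => ?_, fun x => ?_⟩
  · exact heF _
  · obtain ⟨y, hy, hd⟩ := hF x
    obtain ⟨n, hn, rfl⟩ := List.getElem_of_mem (Finset.mem_toList.mpr hy)
    have h1 := SimpleFunc.edist_nearestPt_le e x (k := n) (N := F.card)
      (by rw [Finset.length_toList] at hn; exact hn.le)
    have h2 : e n = F.toList[n] := List.getD_eq_getElem _ _ hn
    rw [h2, edist_dist, edist_dist] at h1
    rw [ENNReal.ofReal_le_ofReal_iff dist_nonneg] at h1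
    rw [dist_comm]
    exact h1.trans (by rwa [dist_comm])

lemma coverWass_upper (X : Type*) [MetricSpace X] [CompactSpace X] [MeasurableSpace X]
    [BorelSpace X] {p : ℝ} (hp : 1 ≤ p) {ε R : ℝ} (hε : 0 < ε)
    (hR : ∀ x y : X, dist x y ≤ R) (m : ℕ) (hm : 0 < m)
    (hmb : R ^ p * (coverNum X (ε / 2) / m) ≤ ε ^ p / 2) :
    ∃ F : Finset (Measure X), F.card ≤ (m + 1) ^ coverNum X (ε / 2) ∧
      (∀ μ ∈ F, IsProbabilityMeasure μ) ∧
      ∀ μ : Measure X, IsProbabilityMeasure μ → ∃ ν ∈ F, Wass p μ ν ≤ ε := by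
  classical
  rcases isEmpty_or_nonempty X with hX | hX
  · refine ⟨∅, by simp, by simp, fun μ hμ => ?_⟩
    have := hμ.measure_univ
    rw [univ_eq_empty_iff.mpr hX] at this
    simp at this
  obtain ⟨F, hFc, hF⟩ := coverNum_spec X (half_pos hε)
  obtain ⟨T, hT, hTF, hTd⟩ := exists_nearest F hF
  obtain ⟨x0⟩ := hX
  let ext : (F → Fin (m + 1)) → X → ℕ := fun g x => if h : x ∈ F then (g ⟨x, h⟩ : ℕ) else 0
  let G : Finset (Measure X) :=
    (Finset.univ.image fun g : F → Fin (m + 1) => discMeas F x0 m (ext g)).filter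
      IsProbabilityMeasure
  refine ⟨G, ?_, ?_, ?_⟩
  · refine (Finset.card_filter_le _ _).trans (Finset.card_image_le.trans ?_)
    simp [hFc]
  · intro μ hμ; exact (Finset.mem_filter.mp hμ).2
  · intro μ hμ
    obtain ⟨k, hk, hprob, π, hπ, hcost⟩ := exists_disc hp F x0 T hT hTF (half_pos hε).le hTd hR m hm μ
    refine ⟨discMeas F x0 m k, ?_, wass_le_of_coupling hp hπ hε.le (hcost.trans ?_)⟩
    · refine Finset.mem_filter.mpr ⟨Finset.mem_image.mpr
        ⟨fun i => ⟨k i, Nat.lt_succ_of_le (hk i)⟩, Finset.mem_univ _, ?_⟩, hprob⟩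
      have : ∀ i ∈ F, ext (fun i => ⟨k i, Nat.lt_succ_of_le (hk i)⟩) i = k i := by
        intro i hi; simp [ext, hi]
      unfold discMeas
      congr 1
      · exact Finset.sum_congr rfl fun i hi => by rw [this i hi]
      · congr 2
        exact Finset.sum_congr rfl fun i hi => by rw [this i hi]
    · rw [hFc]
      have h2 : (ε / 2) ^ p ≤ ε ^ p / 2 := by
        rw [Real.div_rpow hε.le (by norm_num)]
        have : (2 : ℝ) ≤ 2 ^ p := by
          simpa using Real.rpow_le_rpow_of_exponent_le (x := (2 : ℝ)) (by norm_num) hp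
        have h3 : 0 ≤ ε ^ p := by positivity
        gcongr
      linarith

lemma lip_le_wass {X : Type*} [MetricSpace X] [CompactSpace X] [MeasurableSpace X] [BorelSpace X]
    {p : ℝ} (hp : 1 ≤ p) (μ ν : Measure X) [IsProbabilityMeasure μ] [IsProbabilityMeasure ν]
    (φ : X → ℝ) (hφ : ∀ x y, φ x ≤ φ y + dist x y) :
    |∫ x, φ x ∂μ - ∫ x, φ x ∂ν| ≤ Wass p μ ν := by
  have : SecondCountableTopology X := by
    have : TopologicalSpace.SeparableSpace X := inferInstance
    exact UniformSpace.secondCountable_of_separable X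
  have hφc : Continuous φ := (LipschitzWith.of_le_add hφ).continuous
  refine le_csInf ⟨_, μ.prod ν, ⟨?_, ?_⟩, rfl⟩ ?_
  · simp
  · simp
  rintro _ ⟨π, ⟨h1, h2⟩, rfl⟩
  have hπu : IsProbabilityMeasure π := by
    constructor
    have : (π.map Prod.fst) univ = 1 := by rw [h1]; exact measure_univ
    rwa [Measure.map_apply measurable_fst MeasurableSet.univ, preimage_univ] at this
  have hint : ∀ f : X × X → ℝ, Continuous f → Integrable f π := fun f hf =>
    hf.integrable_of_hasCompactSupport (HasCompactSupport.of_compactSpace f)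
  have e1 : ∫ x, φ x ∂μ = ∫ z, φ z.1 ∂π := by
    rw [← h1, integral_map measurable_fst.aemeasurable hφc.aestronglyMeasurable]
  have e2 : ∫ x, φ x ∂ν = ∫ z, φ z.2 ∂π := by
    rw [← h2, integral_map measurable_snd.aemeasurable hφc.aestronglyMeasurable]
  have hp0 : 0 ≤ p := by linarith
  have hcp : Continuous fun z : X × X => dist z.1 z.2 ^ p :=
    continuous_dist.rpow_const fun _ => Or.inr hp0
  have hA : |∫ x, φ x ∂μ - ∫ x, φ x ∂ν| ≤ ∫ z, dist z.1 z.2 ∂π := by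
    rw [e1, e2, ← integral_sub (hint _ (by fun_prop)) (hint _ (by fun_prop))]
    refine abs_integral_le_integral_abs.trans ?_
    refine integral_mono (hint _ (by fun_prop)) (hint _ continuous_dist) fun z => ?_
    have a := hφ z.1 z.2
    have b := hφ z.2 z.1
    rw [dist_comm] at b
    exact abs_le.mpr ⟨by linarith, by linarith⟩
  have hB : (∫ z, dist z.1 z.2 ∂π) ^ p ≤ ∫ z, dist z.1 z.2 ^ p ∂π := by
    refine (convexOn_rpow hp).map_integral_le ?_ isClosed_Ici ?_ (hint _ continuous_dist)
      (hint _ hcp)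
    · exact continuousOn_id.rpow_const fun _ _ => Or.inr hp0
    · exact Eventually.of_forall fun z => dist_nonneg
  refine hA.trans ?_
  have h0 : 0 ≤ ∫ z, dist z.1 z.2 ∂π := integral_nonneg fun z => dist_nonneg
  calc ∫ z, dist z.1 z.2 ∂π = ((∫ z, dist z.1 z.2 ∂π) ^ p) ^ (1 / p) := by
        rw [← Real.rpow_mul h0, mul_one_div_cancel (by linarith), Real.rpow_one]
    _ ≤ _ := Real.rpow_le_rpow (by positivity) hB (by positivity)

/-- Measures coming from a Reed–Solomon code. -/
noncomputable def codeMeas {X : Type*} [MeasurableSpace X] (q : ℕ) [Fact q.Prime]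
    (e : ZMod q × ZMod q → X) (f : ZMod q → ZMod q) : Measure X :=
  ∑ x : ZMod q, (q : ℝ≥0∞)⁻¹ • Measure.dirac (e (x, f x))

lemma codeMeas_prob {X : Type*} [MeasurableSpace X] (q : ℕ) [hq : Fact q.Prime]
    (e : ZMod q × ZMod q → X) (f : ZMod q → ZMod q) : IsProbabilityMeasure (codeMeas q e f) := by
  constructor
  simp [codeMeas, ZMod.card]
  exact ENNReal.mul_inv_cancel (by exact_mod_cast hq.out.ne_zero) (ENNReal.natCast_ne_top q)

lemma codeMeas_integral {X : Type*} [MetricSpace X] [MeasurableSpace X] [BorelSpace X] (q : ℕ)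
    [hq : Fact q.Prime]
    (e : ZMod q × ZMod q → X) (f : ZMod q → ZMod q) (φ : X → ℝ) :
    ∫ x, φ x ∂(codeMeas q e f) = (∑ x : ZMod q, φ (e (x, f x))) / q := by
  have hq0 : (q : ℝ≥0∞) ≠ 0 := by exact_mod_cast hq.out.ne_zero
  rw [codeMeas, integral_finsetSum_measure]
  · simp only [integral_smul_measure, integral_dirac, ENNReal.toReal_inv, ENNReal.toReal_natCast,
      smul_eq_mul]
    rw [← Finset.mul_sum, div_eq_inv_mul]
  · intro i _
    refine Integrable.smul_measure ?_ (ENNReal.inv_ne_top.mpr hq0)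
    exact integrable_dirac (by simp)

lemma code_sep {X : Type*} [MetricSpace X] [CompactSpace X] [MeasurableSpace X] [BorelSpace X]
    {p : ℝ} (hp : 1 ≤ p) {ε : ℝ} (hε : 0 < ε) (q : ℕ) [hq : Fact q.Prime]
    (e : ZMod q × ZMod q → X) (he : ∀ a b, a ≠ b → ε < dist (e a) (e b))
    (f g : ZMod q → ZMod q) (hfg : 2 * (Finset.univ.filter fun x => f x = g x).card ≤ q)
    (ν : Measure X) [IsProbabilityMeasure ν] (h1 : Wass p (codeMeas q e f) ν ≤ ε / 5)
    (h2 : Wass p (codeMeas q e g) ν ≤ ε / 5) : False := by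
  classical
  set S : Set X := range fun x : ZMod q => e (x, f x) with hS
  have hSne : S.Nonempty := range_nonempty _
  set φ : X → ℝ := fun y => max 0 (ε - infDist y S) with hφ
  have hlip : ∀ x y, φ x ≤ φ y + dist x y := by
    intro x y
    have h := infDist_le_infDist_add_dist (s := S) (x := y) (y := x)
    rw [dist_comm] at h
    refine max_le (add_nonneg (le_max_left _ _) dist_nonneg) ?_
    have : ε - infDist y S ≤ φ y := le_max_right _ _
    linarith
  have hpf := codeMeas_prob q e f
  have hpg := codeMeas_prob q e g
  have a1 := (lip_le_wass hp (codeMeas q e f) ν φ hlip).trans h1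
  have a2 := (lip_le_wass hp (codeMeas q e g) ν φ hlip).trans h2
  have hq0 : (0 : ℝ) < q := by exact_mod_cast hq.out.pos
  have i1 : ∫ x, φ x ∂(codeMeas q e f) = ε := by
    rw [codeMeas_integral]
    have : ∀ x : ZMod q, φ (e (x, f x)) = ε := fun x => by
      simp only [hφ]
      rw [infDist_zero_of_mem (show e (x, f x) ∈ S from ⟨x, rfl⟩), sub_zero, max_eq_right hε.le]
    simp only [this, Finset.sum_const, Finset.card_univ, ZMod.card, nsmul_eq_mul]
    field_simp
  have i2 : ∫ x, φ x ∂(codeMeas q e g) ≤ ε / 2 := by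
    rw [codeMeas_integral]
    have : ∀ x : ZMod q, φ (e (x, g x)) ≤ if f x = g x then ε else 0 := fun x => by
      simp only [hφ]
      split_ifs with h
      · refine max_le hε.le ?_
        have := infDist_nonneg (x := e (x, g x)) (s := S)
        linarith
      · refine max_le le_rfl ?_
        have : ε ≤ infDist (e (x, g x)) S := by
          rw [le_infDist hSne]
          rintro _ ⟨y, rfl⟩
          refine (he _ _ ?_).le
          rintro h'
          simp only [Prod.mk.injEq] at h'
          obtain ⟨rfl, h''⟩ := h'
          exact h h''.symm
        linarith
    have hs := Finset.sum_le_sum fun x (_ : x ∈ Finset.univ) => this x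
    rw [← Finset.sum_filter, Finset.sum_const, nsmul_eq_mul] at hs
    rw [div_le_iff₀ hq0]
    refine hs.trans ?_
    have : (2 : ℝ) * ((Finset.univ.filter fun x => f x = g x).card : ℝ) ≤ q := by
      exact_mod_cast hfg
    nlinarith
  rw [abs_le] at a1 a2
  linarith [a1.1, a1.2, a2.1, a2.2]

lemma code_count {X : Type*} [MetricSpace X] [CompactSpace X] [MeasurableSpace X] [BorelSpace X]
    {p : ℝ} (hp : 1 ≤ p) {ε : ℝ} (hε : 0 < ε) (q : ℕ) [hq : Fact q.Prime]
    (e : ZMod q × ZMod q → X) (he : ∀ a b, a ≠ b → ε < dist (e a) (e b))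
    (F : Finset (Measure X)) (hFp : ∀ μ ∈ F, IsProbabilityMeasure μ)
    (hF : ∀ μ : Measure X, IsProbabilityMeasure μ → ∃ ν ∈ F, Wass p μ ν ≤ ε / 5) :
    q ^ ((q + 1) / 2) ≤ F.card := by
  classical
  set k := (q + 1) / 2 with hk
  let P : (Fin k → ZMod q) → Polynomial (ZMod q) := fun c =>
    ((Polynomial.degreeLTEquiv (ZMod q) k).symm c : Polynomial (ZMod q))
  have hPd : ∀ c, (P c).degree < k := fun c =>
    Polynomial.mem_degreeLT.mp ((Polynomial.degreeLTEquiv (ZMod q) k).symm c).2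
  have hPinj : Function.Injective P := fun a b h =>
    (Polynomial.degreeLTEquiv (ZMod q) k).symm.injective (Subtype.ext h)
  choose N hNF hNW using fun c : Fin k → ZMod q =>
    hF (codeMeas q e fun x => (P c).eval x) (codeMeas_prob q e _)
  have hN : Function.Injective N := by
    intro a b hab
    by_contra hne
    have := hFp _ (hNF a)
    refine code_sep hp hε q e he (fun x => (P a).eval x) (fun x => (P b).eval x) ?_ (N a)
      (hNW a) (hab ▸ hNW b)
    by_contra hlt
    refine hne (hPinj ?_)
    refine Polynomial.eq_of_degree_sub_lt_of_eval_finset_eq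
      (Finset.univ.filter fun x => (P a).eval x = (P b).eval x) ?_ ?_
    · refine (Polynomial.degree_sub_le _ _).trans_lt ?_
      refine (max_lt (hPd a) (hPd b)).trans_le ?_
      have : k ≤ (Finset.univ.filter fun x => (P a).eval x = (P b).eval x).card := by omega
      exact_mod_cast this
    · intro x hx
      exact (Finset.mem_filter.mp hx).2
  have := Finset.card_le_card_of_injOn (s := Finset.univ) (t := F) N (fun c _ => hNF c)
    hN.injOn
  simpa [ZMod.card] using this

lemma exists_sep (X : Type*) [MetricSpace X] (ε : ℝ) (n : ℕ) (hn : n ≤ coverNum X ε) :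
    ∃ F : Finset X, F.card = n ∧ ∀ x ∈ F, ∀ y ∈ F, x ≠ y → ε < dist x y := by
  classical
  induction n with
  | zero => exact ⟨∅, by simp⟩
  | succ n ih =>
    obtain ⟨F, hc, hs⟩ := ih (by omega)
    have : ¬ ∀ x : X, ∃ y ∈ F, dist x y ≤ ε := fun h => by
      have : coverNum X ε ≤ n := Nat.sInf_le ⟨F, hc, h⟩
      omega
    push Not at this
    obtain ⟨x, hx⟩ := this
    by_cases hxF : x ∈ F
    · -- then `ε < 0`, and coverings would be impossible
      have h0 := hx x hxF
      rw [dist_self] at h0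
      have : coverNum X ε ≤ 0 := by
        have : coverNum X ε = 0 := by
          rw [coverNum, Nat.sInf_eq_zero]
          right
          rw [Set.eq_empty_iff_forall_notMem]
          rintro n ⟨G, -, hG⟩
          obtain ⟨y, -, hy⟩ := hG x
          linarith [dist_nonneg (x := x) (y := y)]
        exact this.le
      omega
    · refine ⟨insert x F, by rw [Finset.card_insert_of_notMem hxF, hc], ?_⟩
      intro a ha b hb hab
      rw [Finset.mem_insert] at ha hb
      rcases ha with rfl | ha <;> rcases hb with rfl | hb
      · exact absurd rfl hab
      · exact hx b hb
      · rw [dist_comm]; exact hx a ha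
      · exact hs a ha b hb hab

lemma exists_diam (X : Type*) [MetricSpace X] [CompactSpace X] :
    ∃ R : ℝ, 1 ≤ R ∧ ∀ x y : X, dist x y ≤ R := by
  obtain ⟨C, hC⟩ := Metric.isBounded_iff.mp (isCompact_univ (X := X)).isBounded
  exact ⟨max 1 C, le_max_left _ _, fun x y =>
    (hC (mem_univ x) (mem_univ y)).trans (le_max_right _ _)⟩

lemma coverWass_spec (X : Type*) [MetricSpace X] [CompactSpace X] [MeasurableSpace X]
    [BorelSpace X] {p : ℝ} (hp : 1 ≤ p) {ε : ℝ} (hε : 0 < ε) :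
    ∃ F : Finset (Measure X), F.card = coverWass X p ε ∧ (∀ μ ∈ F, IsProbabilityMeasure μ) ∧
      ∀ μ : Measure X, IsProbabilityMeasure μ → ∃ ν ∈ F, Wass p μ ν ≤ ε := by
  have : coverWass X p ε ∈ {n | ∃ F : Finset (Measure X), F.card = n ∧
      (∀ μ ∈ F, IsProbabilityMeasure μ) ∧
      ∀ μ : Measure X, IsProbabilityMeasure μ → ∃ ν ∈ F, Wass p μ ν ≤ ε} := by
    apply Nat.sInf_mem
    obtain ⟨R, hR1, hR⟩ := exists_diam X
    set m := ⌈R ^ p * coverNum X (ε / 2) / (ε ^ p / 2)⌉₊ + 1 with hm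
    have hεp : 0 < ε ^ p / 2 := by positivity
    obtain ⟨F, -, h⟩ := coverWass_upper X hp hε hR m (by omega) (by
      have h1 : R ^ p * coverNum X (ε / 2) / (ε ^ p / 2) ≤ m := by
        rw [hm]; push_cast
        exact (Nat.le_ceil _).trans (by linarith)
      rw [div_le_iff₀ hεp] at h1
      have hm0 : (0 : ℝ) < m := by rw [hm]; positivity
      rw [← mul_div_assoc, div_le_iff₀ hm0]
      linarith)
    exact ⟨_, F, rfl, h⟩
  exact this

lemma coverWass_lower (X : Type*) [MetricSpace X] [CompactSpace X] [MeasurableSpace X]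
    [BorelSpace X] {p : ℝ} (hp : 1 ≤ p) {ε : ℝ} (hε : 0 < ε) (h4 : 4 ≤ coverNum X ε) :
    Real.sqrt (coverNum X ε) / 8 ≤ Real.log (coverWass X p (ε / 5)) := by
  obtain ⟨F, hFc, hFs⟩ := exists_sep X ε _ le_rfl
  set N := coverNum X ε with hN
  set r := Nat.sqrt N with hr
  have hr2 : 2 ≤ r := Nat.le_sqrt.mpr (by omega)
  obtain ⟨q, hqp, hq1, hq2⟩ := Nat.exists_prime_lt_and_le_two_mul (r / 2) (by omega)
  have : Fact q.Prime := ⟨hqp⟩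
  have hqr : q ≤ r := by omega
  have hrq : r + 1 ≤ 2 * q := by omega
  have hqN : q * q ≤ N := (Nat.mul_le_mul hqr hqr).trans (Nat.sqrt_le N)
  have hNq : N ≤ (2 * q) * (2 * q) :=
    (Nat.lt_succ_sqrt N).le.trans (Nat.mul_le_mul hrq hrq)
  obtain ⟨e⟩ : Nonempty (ZMod q × ZMod q ↪ F) := by
    apply Function.Embedding.nonempty_of_card_le
    simp [ZMod.card, hFc, hqN]
  obtain ⟨G, hGc, hGp, hG⟩ := coverWass_spec X hp (ε := ε / 5) (by positivity)
  have hcount := code_count hp hε q (fun z => (e z : X)) (fun a b hab =>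
    hFs _ (e a).2 _ (e b).2 fun h => hab (e.injective (Subtype.ext h))) G hGp hG
  rw [hGc] at hcount
  have h2 : 2 ^ ((q + 1) / 2) ≤ coverWass X p (ε / 5) :=
    (Nat.pow_le_pow_left hqp.two_le _).trans hcount
  have h3 : ((q + 1) / 2 : ℕ) * Real.log 2 ≤ Real.log (coverWass X p (ε / 5)) := by
    rw [← Real.log_pow]
    apply Real.log_le_log (by positivity)
    exact_mod_cast h2
  have h4' : (q : ℝ) / 2 ≤ ((q + 1) / 2 : ℕ) := by
    have : q ≤ 2 * ((q + 1) / 2) := by omega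
    have : (q : ℝ) ≤ 2 * ((q + 1) / 2 : ℕ) := by exact_mod_cast this
    linarith
  have h5 : Real.sqrt N ≤ 2 * q := by
    rw [Real.sqrt_le_left (by positivity), pow_two]
    exact_mod_cast hNq
  have h6 := Real.log_two_gt_d9
  have hq0 : (0 : ℝ) ≤ q := by positivity
  nlinarith

lemma loglog_upper (X : Type*) [MetricSpace X] [CompactSpace X] [MeasurableSpace X]
    [BorelSpace X] {p : ℝ} (hp : 1 ≤ p) {ε R B : ℝ} (hε : 0 < ε) (hε1 : ε < 1) (hR1 : 1 ≤ R)
    (hR : ∀ x y : X, dist x y ≤ R) (hB1 : 1 ≤ B)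
    (hB : Real.log 4 + Real.log (coverNum X (ε / 2)) + p * Real.log R + p * (-Real.log ε) ≤ B) :
    Real.log (Real.log (coverWass X p ε)) ≤ Real.log (coverNum X (ε / 2)) + Real.log B := by
  set n := coverNum X (ε / 2) with hn
  have hlogn : 0 ≤ Real.log n := Real.log_natCast_nonneg n
  have hlogB : 0 ≤ Real.log B := Real.log_nonneg hB1
  have hεp : 0 < ε ^ p := by positivity
  have hRp : 1 ≤ R ^ p := Real.one_le_rpow hR1 (by linarith)
  have hεp1 : ε ^ p ≤ 1 := Real.rpow_le_one hε.le hε1.le (by linarith)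
  have key : ∀ M : ℕ, coverWass X p ε ≤ M → Real.log M ≤ n * B →
      Real.log (Real.log (coverWass X p ε)) ≤ Real.log n + Real.log B := by
    intro M hM hMB
    rcases Nat.lt_or_ge (coverWass X p ε) 2 with h | h
    · have : Real.log (coverWass X p ε) = 0 := by interval_cases (coverWass X p ε) <;> simp
      rw [this, Real.log_zero]; positivity
    · have h2 : (2 : ℝ) ≤ coverWass X p ε := by exact_mod_cast h
      have h3 : 0 < Real.log (coverWass X p ε) := Real.log_pos (by linarith)
      have h4 : Real.log (coverWass X p ε) ≤ n * B := by
        refine le_trans (Real.log_le_log (by linarith) ?_) hMB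
        exact_mod_cast hM
      have hn0 : (n : ℝ) ≠ 0 := by
        intro h0; rw [h0] at h4; linarith
      rw [← Real.log_mul hn0 (by linarith)]
      exact Real.log_le_log h3 h4
  rcases Nat.eq_zero_or_pos n with h0 | hpos
  · obtain ⟨F, hFc, h⟩ := coverWass_upper X hp hε hR 1 one_pos (by
      rw [← hn, h0]; simp; positivity)
    refine key 1 ?_ (by simp [h0])
    refine le_trans (Nat.sInf_le ⟨F, rfl, h⟩) ?_
    rw [← hn, h0] at hFc
    simpa using hFc
  · have hn1 : (1 : ℝ) ≤ n := by exact_mod_cast hpos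
    set Y : ℝ := R ^ p * n / (ε ^ p / 2) with hY
    have hY2 : 2 ≤ Y := by
      rw [hY, le_div_iff₀ (by positivity)]
      nlinarith
    have hm0 : 0 < ⌈Y⌉₊ := Nat.ceil_pos.mpr (by linarith)
    obtain ⟨F, hFc, h⟩ := coverWass_upper X hp hε hR ⌈Y⌉₊ hm0 (by
      have h1 : Y ≤ ⌈Y⌉₊ := Nat.le_ceil _
      rw [hY, div_le_iff₀ (by positivity), ← hY] at h1
      have hm0' : (0 : ℝ) < ⌈Y⌉₊ := by exact_mod_cast hm0
      rw [← mul_div_assoc, div_le_iff₀ hm0']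
      rw [← hn]
      linarith)
    refine key ((⌈Y⌉₊ + 1) ^ n) (le_trans (Nat.sInf_le ⟨F, rfl, h⟩) hFc) ?_
    push_cast
    rw [Real.log_pow]
    refine mul_le_mul_of_nonneg_left (le_trans ?_ hB) (by positivity)
    have hc := (Nat.ceil_lt_add_one (a := Y) (by linarith)).le
    have hle : (⌈Y⌉₊ : ℝ) + 1 ≤ 4 * n * R ^ p * (ε ^ p)⁻¹ := by
      have : 4 * n * R ^ p * (ε ^ p)⁻¹ = 2 * Y := by rw [hY]; field_simp; norm_num
      rw [this]; linarith
    refine (Real.log_le_log (by positivity) hle).trans (le_of_eq ?_)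
    have hn0 : (n : ℝ) ≠ 0 := by positivity
    rw [Real.log_mul (by positivity) (by positivity), Real.log_mul (by positivity) (by positivity),
      Real.log_mul (by positivity) hn0, Real.log_inv, Real.log_rpow hε,
      Real.log_rpow (by linarith)]
    ring

lemma neg_one_le_loglog (n : ℕ) : -1 ≤ Real.log (Real.log n) := by
  rcases Nat.lt_or_ge n 2 with h | h
  · interval_cases n <;> simp
  · have h2 : (2 : ℝ) ≤ n := by exact_mod_cast h
    have h3 : Real.log 2 ≤ Real.log n := Real.log_le_log (by norm_num) h2
    have h6 := Real.log_two_gt_d9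
    have h7 : 1 / 2 ≤ Real.log n := by linarith
    have := Real.one_sub_inv_le_log_of_pos (show 0 < Real.log n by linarith)
    have h8 : (Real.log n)⁻¹ ≤ (1 / 2)⁻¹ := by gcongr
    norm_num at h8
    linarith

theorem stmt7 (X : Type*) [MetricSpace X] [CompactSpace X] [MeasurableSpace X] [BorelSpace X]
    (p : ℝ) (hp : 1 ≤ p) :
    limsup (fun ε : ℝ => Real.log (Real.log (coverWass X p ε)) / (-Real.log ε))
        (nhdsWithin 0 (Set.Ioi 0)) ≤
      limsup (fun ε : ℝ => Real.log (coverNum X ε) / (-Real.log ε))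
        (nhdsWithin 0 (Set.Ioi 0)) := by
  set l : Filter ℝ := nhdsWithin 0 (Set.Ioi 0) with hl
  set u : ℝ → ℝ := fun ε => Real.log (Real.log (coverWass X p ε)) / (-Real.log ε) with hu
  set v : ℝ → ℝ := fun ε => Real.log (coverNum X ε) / (-Real.log ε) with hv
  have hL : Tendsto (fun ε : ℝ => -Real.log ε) l atTop :=
    tendsto_neg_atBot_atTop.comp Real.tendsto_log_nhdsGT_zero
  have hpos : ∀ᶠ ε in l, (0 : ℝ) < ε := eventually_mem_nhdsWithin
  have hscale : ∀ c : ℝ, 0 < c → Tendsto (fun ε : ℝ => ε / c) l l := by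
    intro c hc
    refine tendsto_nhdsWithin_iff.mpr ⟨?_, ?_⟩
    · have : Tendsto (fun ε : ℝ => ε / c) (nhds 0) (nhds (0 / c)) :=
        (continuous_id.div_const c).tendsto 0
      rw [zero_div] at this
      exact this.mono_left nhdsWithin_le_nhds
    · filter_upwards [hpos] with ε hε
      exact div_pos hε hc
  by_cases hb : l.IsBoundedUnder (· ≤ ·) v
  · refine le_of_forall_pos_le_add fun η hη => ?_
    have hcob : l.IsCoboundedUnder (· ≤ ·) u := by
      refine IsBoundedUnder.isCoboundedUnder_le ⟨-1, ?_⟩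
      rw [eventually_map]
      filter_upwards [hL.eventually_ge_atTop 1] with ε h1
      have h2 := neg_one_le_loglog (coverWass X p ε)
      show -1 ≤ u ε
      rw [hu]
      simp only
      rw [le_div_iff₀ (by linarith)]
      linarith
    refine limsup_le_of_le hcob ?_
    obtain ⟨R, hR1, hR⟩ := exists_diam X
    have hlogR : 0 ≤ Real.log R := Real.log_nonneg hR1
    set a := limsup v l + η / 2 with ha
    have hva : ∀ᶠ ε in l, v ε < a := eventually_lt_of_limsup_lt (by linarith) hb
    set K : ℝ := 2 + |a| + p * Real.log R + p with hK
    have hK1 : 1 ≤ K := by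
      have := mul_nonneg (show 0 ≤ p by linarith) hlogR
      have := abs_nonneg a
      linarith
    filter_upwards [hpos, (hscale 2 two_pos).eventually hva, hL.eventually_ge_atTop 1,
      hL.eventually_ge_atTop
        ((a * Real.log 2 + Real.log K + η / 4 + Real.log (4 / η)) / (η / 4))]
      with ε hε hvε hL1 hLbig
    set L := -Real.log ε with hLdef
    have hlog2 : 0 < Real.log 2 := Real.log_pos (by norm_num)
    have hlog2' : Real.log 2 < 1 := by linarith [Real.log_two_lt_d9]
    have hlogh : -Real.log (ε / 2) = Real.log 2 + L := by
      rw [Real.log_div hε.ne' (by norm_num)]; ring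
    have hε1 : ε < 1 := by
      by_contra h
      have := Real.log_nonneg (not_lt.mp h)
      linarith
    have hn : Real.log (coverNum X (ε / 2)) ≤ a * (Real.log 2 + L) := by
      simp only [hv] at hvε
      rw [hlogh, div_lt_iff₀ (by linarith)] at hvε
      exact hvε.le
    have hn2 : Real.log (coverNum X (ε / 2)) ≤ |a| * (1 + L) := by
      refine hn.trans ?_
      have := le_abs_self a
      have := abs_nonneg a
      nlinarith
    have hlog4 : Real.log 4 ≤ 2 := by
      have : (4 : ℝ) = 2 ^ 2 := by norm_num
      rw [this, Real.log_pow]; push_cast; linarith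
    have hmain := loglog_upper X hp hε hε1 hR1 hR (B := K * (1 + L)) (by nlinarith) (by
      rw [← hLdef]
      have h1 : 0 ≤ p * Real.log R := mul_nonneg (by linarith) hlogR
      have h2 : 0 ≤ p * Real.log R * L := mul_nonneg h1 (by linarith)
      rw [hK]
      nlinarith)
    rw [Real.log_mul (by linarith) (by linarith)] at hmain
    have hlogL : Real.log (1 + L) ≤ η / 4 * (1 + L) + Real.log (4 / η) := by
      have h1 := Real.log_le_sub_one_of_pos (show 0 < η / 4 * (1 + L) by positivity)
      have h2 : Real.log (1 + L) = Real.log (η / 4 * (1 + L)) + Real.log (4 / η) := by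
        rw [← Real.log_mul (by positivity) (by positivity)]
        congr 1; field_simp
      linarith
    rw [div_le_iff₀ (by positivity)] at hLbig
    show u ε ≤ _
    simp only [hu]
    rw [← hLdef, div_le_iff₀ (by linarith)]
    have : limsup v l + η = a + η / 2 := by rw [ha]; ring
    rw [this]
    nlinarith
  · have hub : ¬ l.IsBoundedUnder (· ≤ ·) u := by
      rintro ⟨b0, hb0⟩
      rw [eventually_map] at hb0
      apply hb
      set b := max b0 0 with hbdef
      have hb0' : 0 ≤ b := le_max_right _ _
      refine ⟨2 * b + 1, ?_⟩
      rw [eventually_map]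
      filter_upwards [hpos, (hscale 5 (by norm_num)).eventually hb0, hL.eventually_ge_atTop 1,
        hL.eventually_ge_atTop (2 * Real.log 8 + 2 * b * Real.log 5)] with ε hε hue hL1 hLbig
      set L := -Real.log ε with hLdef
      have hlog5 : 0 < Real.log 5 := Real.log_pos (by norm_num)
      have hlog8 : 0 < Real.log 8 := Real.log_pos (by norm_num)
      have hlogh : -Real.log (ε / 5) = Real.log 5 + L := by
        rw [Real.log_div hε.ne' (by norm_num)]; ring
      show v ε ≤ _
      simp only [hv]
      rw [← hLdef, div_le_iff₀ (by linarith)]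
      have hbl : 0 ≤ 2 * b * Real.log 5 := by positivity
      have hbL : 0 ≤ b * L := mul_nonneg hb0' (by linarith)
      rcases Nat.lt_or_ge (coverNum X ε) 4 with h | h
      · have : Real.log (coverNum X ε) ≤ Real.log 8 := by
          rcases Nat.eq_zero_or_pos (coverNum X ε) with h0 | h0
          · rw [h0]; simp; exact hlog8.le
          · apply Real.log_le_log (by exact_mod_cast h0)
            have : coverNum X ε ≤ 8 := by omega
            exact_mod_cast this
        linarith
      · have hlow := coverWass_lower X hp hε h
        have hN : (0 : ℝ) < coverNum X ε := by
          have : 0 < coverNum X ε := by omega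
          exact_mod_cast this
        have h2 := Real.log_le_log (by positivity) hlow
        rw [Real.log_div (by positivity) (by norm_num), Real.log_sqrt hN.le] at h2
        simp only [hu] at hue
        rw [hlogh, div_le_iff₀ (by linarith)] at hue
        have h3 : b0 * (Real.log 5 + L) ≤ b * (Real.log 5 + L) :=
          mul_le_mul_of_nonneg_right (le_max_left _ _) (by linarith)
        linarith
    have e1 : ∀ w : ℝ → ℝ, ¬ l.IsBoundedUnder (· ≤ ·) w → limsup w l = 0 := by
      intro w hw
      rw [limsup_eq]
      have : {a | ∀ᶠ n in l, w n ≤ a} = ∅ := by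
        rw [Set.eq_empty_iff_forall_notMem]
        intro a ha
        exact hw ⟨a, by rw [eventually_map]; exact ha⟩
      rw [this, Real.sInf_empty]
    rw [e1 u hub, e1 v hb]
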